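/- arXiv:2210.04740 — 3 statements merged into one kernel-verified Lean document; each statement's English description precedes it below -/
import Mathlib

section
/- For every τ > 0 there exists c(τ) > 0 such that: if K ⊂ ℂ is a measurable τ-fat set (with respect to the Euclidean metric and Lebesgue area) with diam(K) < 1/4, then the image of K under the map g(z) = e^{−2πiz} is c(τ)-fat (with respect to the Euclidean metric and Lebesgue area). -/
open MeasureTheory

noncomputable section

/-- A measurable set `K ⊆ ℂ` is `τ`-fat (w.r.t. the Euclidean metric and Lebesgue area) if
`area(B(x,r) ∩ K) ≥ τ r²` for every `x ∈ K` and every ball `B(x,r)` not containing `K`. -/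
def EucFat (τ : ℝ) (K : Set ℂ) : Prop :=
  MeasurableSet K ∧ ∀ x ∈ K, ∀ r > (0 : ℝ), ¬ K ⊆ Metric.ball x r →
    ENNReal.ofReal (τ * r ^ 2) ≤ volume (Metric.ball x r ∩ K)

open Set

/-- A conformal injection expands area at least by the square of a lower bound on its derivative. -/
theorem ofReal_sq_mul_volume_le_volume_image {f f' : ℂ → ℂ} {s : Set ℂ} {m : ℝ} (hm : 0 ≤ m)
    (hs : MeasurableSet s) (hf : ∀ z ∈ s, HasDerivAt f (f' z) z) (hinj : InjOn f s)
    (hle : ∀ z ∈ s, m ≤ ‖f' z‖) :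
    ENNReal.ofReal (m ^ 2) * volume s ≤ volume (f '' s) := by
  have hd : ∀ z ∈ s, HasFDerivWithinAt f
      ((ContinuousLinearMap.toSpanSingleton ℂ (f' z)).restrictScalars ℝ) s z := fun z hz =>
    ((hf z hz).hasFDerivAt.restrictScalars ℝ).hasFDerivWithinAt
  rw [← lintegral_abs_det_fderiv_eq_addHaar_image volume hs hd hinj, ← setLIntegral_const]
  refine setLIntegral_mono_ae' hs (Filter.Eventually.of_forall fun z hz => ?_)
  have hdet : ((ContinuousLinearMap.toSpanSingleton ℂ (f' z)).restrictScalars ℝ).det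
      = ‖f' z‖ ^ 2 := by
    simp [ContinuousLinearMap.det, LinearMap.det_restrictScalars, Algebra.norm_complex_eq,
      Complex.normSq_eq_norm_sq]
  rw [hdet, abs_of_nonneg (sq_nonneg _)]
  exact ENNReal.ofReal_le_ofReal (pow_le_pow_left₀ hm (hle z hz) 2)

theorem norm_exp_sub_exp_le (a b : ℂ) :
    ‖Complex.exp a - Complex.exp b‖ ≤ ‖Complex.exp b‖ * (‖a - b‖ * Real.exp ‖a - b‖) := by
  have h : Complex.exp a - Complex.exp b = Complex.exp b * (Complex.exp (a - b) - 1) := by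
    rw [mul_sub, ← Complex.exp_add]; simp
  rw [h, norm_mul]
  gcongr
  simpa using Complex.norm_exp_sub_sum_le_norm_mul_exp (a - b) 1

theorem norm_exp_mul_exp_neg_le (a b : ℂ) :
    ‖Complex.exp b‖ * Real.exp (-‖a - b‖) ≤ ‖Complex.exp a‖ := by
  rw [Complex.norm_exp, Complex.norm_exp, ← Real.exp_add, Real.exp_le_exp]
  have h := (abs_le.mp (Complex.abs_re_le_norm (a - b))).1
  rw [Complex.sub_re] at h
  linarith

theorem norm_neg_two_pi_I_mul_sub (z w : ℂ) :
    ‖-2 * Real.pi * Complex.I * z - -2 * Real.pi * Complex.I * w‖ = 2 * Real.pi * dist z w := by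
  rw [← mul_sub, dist_eq_norm]
  simp [abs_of_pos Real.pi_pos]

theorem injOn_exp_neg_two_pi_I_mul {K : Set ℂ} (hK : ∀ z ∈ K, ∀ w ∈ K, dist z w < 1) :
    InjOn (fun z => Complex.exp (-2 * Real.pi * Complex.I * z)) K := by
  intro z hz w hw h
  obtain ⟨n, hn⟩ := Complex.exp_eq_exp_iff_exists_int.mp h
  have hπ : (2 * Real.pi * Complex.I : ℂ) ≠ 0 := Complex.two_pi_I_ne_zero
  have hzw : w - z = n := mul_left_cancel₀ hπ (by linear_combination hn)
  have hlt := hK w hw z hz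
  rw [dist_eq_norm, hzw, Complex.norm_intCast] at hlt
  have h0 : n = 0 := Int.abs_lt_one_iff.mp (by exact_mod_cast hlt)
  rw [h0, Int.cast_zero, sub_eq_zero] at hzw
  exact hzw.symm

theorem hasDerivAt_exp_neg_two_pi_I_mul (z : ℂ) :
    HasDerivAt (fun z => Complex.exp (-2 * Real.pi * Complex.I * z))
      (Complex.exp (-2 * Real.pi * Complex.I * z) * (-2 * Real.pi * Complex.I)) z := by
  simpa using ((hasDerivAt_id z).const_mul (-2 * Real.pi * Complex.I : ℂ)).cexp

/-- The map `z ↦ e^{-2πiz}` carries `τ`-fat sets of diameter less than `1/4` to `c(τ)`-fat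
sets, with `c(τ)` depending only on `τ`. -/
theorem fat_image_under_exp (τ : ℝ) (hτ : 0 < τ) :
    ∃ c : ℝ, 0 < c ∧ ∀ K : Set ℂ, EucFat τ K → EMetric.diam K < ENNReal.ofReal (1/4) →
      EucFat c ((fun z => Complex.exp (-2 * Real.pi * Complex.I * z)) '' K) := by
  have hπ := Real.pi_pos
  refine ⟨τ * Real.exp (-(2 * Real.pi)), by positivity, fun K hK hdiam => ?_⟩
  have hdist : ∀ z ∈ K, ∀ w ∈ K, dist z w < 1 / 4 := fun z hz w hw => by
    have h := (Metric.edist_le_ediam_of_mem hz hw).trans_lt hdiam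
    rwa [edist_dist, ENNReal.ofReal_lt_ofReal_iff (by norm_num)] at h
  set g : ℂ → ℂ := fun z => Complex.exp (-2 * Real.pi * Complex.I * z) with hg
  have hinj : InjOn g K := injOn_exp_neg_two_pi_I_mul fun z hz w hw =>
    (hdist z hz w hw).trans (by norm_num)
  have hcont : Continuous g := by fun_prop
  refine ⟨hK.1.image_of_continuousOn_injOn hcont.continuousOn hinj, ?_⟩
  rintro _ ⟨x, hx, rfl⟩ r hr hsub
  set L : ℝ := 2 * Real.pi * ‖g x‖ with hL
  have hgx : 0 < ‖g x‖ := norm_pos_iff.mpr (Complex.exp_ne_zero _)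
  have hLpos : 0 < L := by positivity
  set E : ℝ := Real.exp (Real.pi / 2) with hE
  have hEpos : 0 < E := Real.exp_pos _
  have hnorm : ∀ z ∈ K, 2 * Real.pi * dist z x ≤ Real.pi / 2 := fun z hz => by
    nlinarith [hdist z hz x hx]
  have hlip : ∀ z ∈ K, dist (g z) (g x) ≤ E * L * dist z x := fun z hz => by
    have h := norm_exp_sub_exp_le (-2 * Real.pi * Complex.I * z) (-2 * Real.pi * Complex.I * x)
    rw [norm_neg_two_pi_I_mul_sub] at h
    rw [dist_eq_norm]
    calc ‖g z - g x‖ ≤ ‖g x‖ * (2 * Real.pi * dist z x * Real.exp (2 * Real.pi * dist z x)) := h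
      _ ≤ ‖g x‖ * (2 * Real.pi * dist z x * E) := by
        gcongr
        exact Real.exp_le_exp.mpr (hnorm z hz)
      _ = E * L * dist z x := by rw [hL]; ring
  have hderiv : ∀ z ∈ K,
      L * E⁻¹ ≤ ‖Complex.exp (-2 * Real.pi * Complex.I * z) * (-2 * Real.pi * Complex.I)‖ :=
    fun z hz => by
    have h := norm_exp_mul_exp_neg_le (-2 * Real.pi * Complex.I * z) (-2 * Real.pi * Complex.I * x)
    rw [norm_neg_two_pi_I_mul_sub] at h
    have hexp : E⁻¹ ≤ Real.exp (-(2 * Real.pi * dist z x)) := by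
      rw [hE, ← Real.exp_neg, Real.exp_le_exp]
      linarith [hnorm z hz]
    have hc : ‖(-2 * Real.pi * Complex.I : ℂ)‖ = 2 * Real.pi := by
      simp [abs_of_pos hπ]
    rw [norm_mul, hc]
    calc L * E⁻¹ = 2 * Real.pi * (‖g x‖ * E⁻¹) := by rw [hL]; ring
      _ ≤ 2 * Real.pi * (‖g x‖ * Real.exp (-(2 * Real.pi * dist z x))) := by gcongr
      _ ≤ 2 * Real.pi * ‖Complex.exp (-2 * Real.pi * Complex.I * z)‖ := by gcongr
      _ = _ := mul_comm _ _
  set s : ℝ := r / (E * L) with hs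
  have hspos : 0 < s := by positivity
  have hmem : ∀ z ∈ K, z ∈ Metric.ball x s → g z ∈ Metric.ball (g x) r := fun z hz hzs => by
    rw [Metric.mem_ball, hs, lt_div_iff₀' (by positivity)] at hzs
    exact (hlip z hz).trans_lt hzs
  have hfat := hK.2 x hx s hspos fun h =>
    hsub (image_subset_iff.mpr fun z hz => hmem z hz (h hz))
  calc ENNReal.ofReal (τ * Real.exp (-(2 * Real.pi)) * r ^ 2)
      = ENNReal.ofReal ((L * E⁻¹) ^ 2) * ENNReal.ofReal (τ * s ^ 2) := by
        rw [← ENNReal.ofReal_mul (by positivity)]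
        congr 1
        have h4 : Real.exp (-(2 * Real.pi)) = (E ^ 4)⁻¹ := by
          rw [hE, ← Real.exp_nat_mul, ← Real.exp_neg]
          congr 1
          push_cast
          ring
        rw [h4, hs]
        field_simp
    _ ≤ ENNReal.ofReal ((L * E⁻¹) ^ 2) * volume (Metric.ball x s ∩ K) := by gcongr
    _ ≤ volume (g '' (Metric.ball x s ∩ K)) :=
        ofReal_sq_mul_volume_le_volume_image (by positivity) (measurableSet_ball.inter hK.1)
          (fun z _ => hasDerivAt_exp_neg_two_pi_I_mul z) (hinj.mono inter_subset_right)
          fun z hz => hderiv z hz.2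
    _ ≤ volume (Metric.ball (g x) r ∩ g '' K) := by
        refine measure_mono ?_
        rintro _ ⟨z, ⟨hzs, hz⟩, rfl⟩
        exact ⟨hmem z hz hzs, z, hz, rfl⟩

end
end

section
/- Let T : ℝ² → ℝ² be a linear map. If T maps some closed ball of positive radius onto a closed ball (possibly degenerate, i.e., a point), then T is a similarity: there exists λ ≥ 0 such that |T(v)| = λ|v| for all v ∈ ℝ². -/
noncomputable section

theorem norm_sub_le_of_mem_closedBall {E : Type*} [SeminormedAddCommGroup E] {x p q : E}
    {r : ℝ} (hp : p ∈ Metric.closedBall x r) (hq : q ∈ Metric.closedBall x r) :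
    ‖p - q‖ ≤ 2 * r := by
  rw [← dist_eq_norm]
  linarith [dist_triangle_right p q x, Metric.mem_closedBall.1 hp, Metric.mem_closedBall.1 hq]

section BallImages

variable {E F : Type*} [NormedAddCommGroup E] [NormedSpace ℝ E]
  [NormedAddCommGroup F] [NormedSpace ℝ F]

/-- Opposite points of a ball, in the direction of a nonzero vector. -/
theorem add_smul_mem_closedBall_and_sub_smul_mem_closedBall (x : E) {r : ℝ} (hr : 0 ≤ r)
    {v : E} (hv : v ≠ 0) :
    x + (r / ‖v‖) • v ∈ Metric.closedBall x r ∧ x - (r / ‖v‖) • v ∈ Metric.closedBall x r := by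
  have hnorm : ‖(r / ‖v‖) • v‖ = r := by
    rw [norm_smul, Real.norm_of_nonneg (by positivity), div_mul_cancel₀ _ (norm_ne_zero_iff.2 hv)]
  constructor <;> simp [dist_eq_norm, hnorm]

/-- A linear map sending a ball of radius `r` into a ball of radius `s` has norm at most `s / r`. -/
theorem LinearMap.norm_le_of_image_closedBall_subset (T : E →ₗ[ℝ] F) {x : E} {y : F} {r s : ℝ}
    (hr : 0 < r) (h : T '' Metric.closedBall x r ⊆ Metric.closedBall y s) (v : E) :
    ‖T v‖ ≤ s / r * ‖v‖ := by
  rcases eq_or_ne v 0 with rfl | hv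
  · simp
  have hv' : 0 < ‖v‖ := norm_pos_iff.2 hv
  obtain ⟨hp, hq⟩ := add_smul_mem_closedBall_and_sub_smul_mem_closedBall x hr.le hv
  have hpq := norm_sub_le_of_mem_closedBall (h ⟨_, hp, rfl⟩) (h ⟨_, hq, rfl⟩)
  rw [← map_sub, show x + (r / ‖v‖) • v - (x - (r / ‖v‖) • v) = (2 * (r / ‖v‖)) • v by module,
    map_smul, norm_smul, Real.norm_of_nonneg (by positivity), mul_assoc] at hpq
  have hle : r / ‖v‖ * ‖T v‖ ≤ s := by linarith
  rw [div_mul_eq_mul_div, div_le_iff₀ hv'] at hle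
  rwa [div_mul_eq_mul_div, le_div_iff₀ hr, mul_comm]

/-- If the image of a ball of radius `r` under a linear map contains a ball of radius `s`, then
every vector `z` has a preimage of norm at most `r / s * ‖z‖`. -/
theorem LinearMap.exists_preimage_norm_le_of_closedBall_subset_image (T : E →ₗ[ℝ] F) {x : E}
    {y : F} {r s : ℝ} (hs : 0 < s) (h : Metric.closedBall y s ⊆ T '' Metric.closedBall x r)
    (z : F) : ∃ u, T u = z ∧ ‖u‖ ≤ r / s * ‖z‖ := by
  rcases eq_or_ne z 0 with rfl | hz
  · exact ⟨0, by simp⟩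
  have hz' : 0 < ‖z‖ := norm_pos_iff.2 hz
  obtain ⟨hyp, hyq⟩ := add_smul_mem_closedBall_and_sub_smul_mem_closedBall y hs.le hz
  obtain ⟨p, hp, hTp⟩ := h hyp
  obtain ⟨q, hq, hTq⟩ := h hyq
  refine ⟨(‖z‖ / (2 * s)) • (p - q), ?_, ?_⟩
  · rw [map_smul, map_sub, hTp, hTq,
      show y + (s / ‖z‖) • z - (y - (s / ‖z‖) • z) = (2 * (s / ‖z‖)) • z by module, smul_smul,
      show ‖z‖ / (2 * s) * (2 * (s / ‖z‖)) = 1 by field_simp, one_smul]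
  · rw [norm_smul, Real.norm_of_nonneg (by positivity)]
    calc ‖z‖ / (2 * s) * ‖p - q‖ ≤ ‖z‖ / (2 * s) * (2 * r) := by
          gcongr
          exact norm_sub_le_of_mem_closedBall hp hq
      _ = r / s * ‖z‖ := by field_simp

end BallImages

/-- A linear map of the Euclidean plane mapping some closed ball of positive radius onto a
closed ball (possibly degenerate, i.e. of radius `0`) is a similarity. -/
theorem linear_map_ball_to_ball_is_similarity
    (T : EuclideanSpace ℝ (Fin 2) →ₗ[ℝ] EuclideanSpace ℝ (Fin 2))
    (h : ∃ (x : EuclideanSpace ℝ (Fin 2)) (r : ℝ), 0 < r ∧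
      ∃ (y : EuclideanSpace ℝ (Fin 2)) (s : ℝ), 0 ≤ s ∧
        T '' Metric.closedBall x r = Metric.closedBall y s) :
    ∃ lam : ℝ, 0 ≤ lam ∧ ∀ v, ‖T v‖ = lam * ‖v‖ := by
  obtain ⟨x, r, hr, y, s, hs, himage⟩ := h
  have hupper := T.norm_le_of_image_closedBall_subset hr himage.subset
  refine ⟨s / r, by positivity, fun v => le_antisymm (hupper v) ?_⟩
  rcases hs.eq_or_lt with rfl | hs'
  · simp
  have hpre := T.exists_preimage_norm_le_of_closedBall_subset_image hs' himage.superset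
  have hinj : Function.Injective T :=
    LinearMap.injective_iff_surjective.2 fun z => (hpre z).imp fun _ hu => hu.1
  obtain ⟨u, hu, hle⟩ := hpre (T v)
  rw [hinj hu, div_mul_eq_mul_div, le_div_iff₀ hs'] at hle
  rw [div_mul_eq_mul_div, div_le_iff₀ hr]
  linarith

end
end

section
/- Let x ∈ ℂ, let f be an injective holomorphic map defined on an open set W ⊂ ℂ containing x, and let A_n ⊂ W be open sets containing x with diam(A_n) → 0. Then E(f(A_n)) = (1 + o(1)) E(A_n) as n → ∞, i.e., E(f(A_n))/E(A_n) → 1, where E denotes eccentricity with respect to the Euclidean metric. -/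
open Filter Set

noncomputable section

/-- The eccentricity of a set in a metric space:
`E(A) = inf {M ≥ 1 : ∃ open ball B with B ⊆ A ⊆ MB}`. -/
def ecc {X : Type*} [PseudoMetricSpace X] (A : Set X) : ℝ :=
  sInf {M | 1 ≤ M ∧ ∃ c r, 0 < r ∧ Metric.ball c r ⊆ A ∧ A ⊆ Metric.ball c (M * r)}

open Topology Complex

theorem ecc_le {X : Type*} [PseudoMetricSpace X] {A : Set X} {M r : ℝ} {c : X} (hM : 1 ≤ M)
    (hr : 0 < r) (h₁ : Metric.ball c r ⊆ A) (h₂ : A ⊆ Metric.ball c (M * r)) : ecc A ≤ M :=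
  csInf_le ⟨1, fun _ h => h.1⟩ ⟨hM, c, r, hr, h₁, h₂⟩

theorem exists_ball_subset_subset_ball {X : Type*} [PseudoMetricSpace X] {A : Set X}
    (hA : (interior A).Nonempty) (hb : Bornology.IsBounded A) :
    {M | 1 ≤ M ∧ ∃ c r, 0 < r ∧ Metric.ball c r ⊆ A ∧ A ⊆ Metric.ball c (M * r)}.Nonempty := by
  obtain ⟨c, hc⟩ := hA
  obtain ⟨r, hr, hrA⟩ := Metric.mem_nhds_iff.1 (mem_interior_iff_mem_nhds.1 hc)
  obtain ⟨R, hR⟩ := hb.subset_ball c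
  refine ⟨max 1 (R / r), le_max_left _ _, c, r, hr, hrA, hR.trans (Metric.ball_subset_ball ?_)⟩
  calc R = R / r * r := by field_simp
    _ ≤ _ := by gcongr; exact le_max_right _ _

theorem one_le_ecc {X : Type*} [PseudoMetricSpace X] {A : Set X}
    (hA : (interior A).Nonempty) (hb : Bornology.IsBounded A) : 1 ≤ ecc A :=
  le_csInf (exists_ball_subset_subset_ball hA hb) fun _ h => h.1

/-- A map which is close to a complex-linear one near `a` increases the eccentricity of small sets
by at most a factor close to `1`. -/
theorem HasStrictDerivAt.eventually_ecc_image_le {f : ℂ → ℂ} {f' a : ℂ}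
    (hf : HasStrictDerivAt f f' a) (hf' : f' ≠ 0) {ε : ℝ} (hε : 0 < ε) :
    ∀ᶠ U in (𝓝 a).smallSets, (interior U).Nonempty → ecc (f '' U) ≤ (1 + ε) * ecc U := by
  have hk : 0 < ‖f'‖ := norm_pos_iff.2 hf'
  obtain ⟨δ, hδ, hδ'⟩ : ∃ δ : ℝ, 0 < δ ∧ 1 + δ = (1 + ε) * (1 - δ) :=
    ⟨ε / (2 + ε), by positivity, by field_simp; ring⟩
  have hδ₁ : δ < 1 := by nlinarith
  have hc : 0 < δ * ‖f'‖ := by positivity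
  obtain ⟨κ, hκ⟩ : ∃ κ : NNReal, (κ : ℝ) = δ * ‖f'‖ := ⟨_, Real.coe_toNNReal _ hc.le⟩
  obtain ⟨s, hs, happ⟩ := hf.hasStrictFDerivAt.approximates_deriv_on_nhds
    (c := κ) (.inr (NNReal.coe_pos.1 (hκ ▸ hc)))
  have hs' := inter_mem hs (Metric.ball_mem_nhds a one_pos)
  filter_upwards [eventually_smallSets_subset.2 hs'] with U hU hne
  suffices H : ecc (f '' U) / (1 + ε) ≤ ecc U by
    rwa [div_le_iff₀ (by positivity), mul_comm] at H
  refine le_csInf (exists_ball_subset_subset_ball hne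
    (Metric.isBounded_ball.subset (hU.trans inter_subset_right))) ?_
  rintro M ⟨hM, c, r, hr, hcU, hUc⟩
  rw [div_le_iff₀ (by positivity)]
  have hUs : U ⊆ s := hU.trans inter_subset_left
  refine ecc_le (c := f c) (r := (1 - δ) * ‖f'‖ * r) (by nlinarith)
    (mul_pos (mul_pos (by linarith) hk) hr) ?_ ?_
  · intro y hy
    rw [Metric.mem_ball] at hy
    have hd : 0 < (1 - δ) * ‖f'‖ := mul_pos (by linarith) hk
    let g : ContinuousLinearMap.NonlinearRightInverse
        (ContinuousLinearMap.toSpanSingleton ℂ f') :=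
      { toFun := fun y => f'⁻¹ * y
        nnnorm := ‖f'‖₊⁻¹
        bound' := fun y => by simp
        right_inv' := fun y => by simp; field_simp }
    have hball : Metric.closedBall c (dist y (f c) / ((1 - δ) * ‖f'‖)) ⊆ U := by
      refine (Metric.closedBall_subset_ball ?_).trans hcU
      rw [div_lt_iff₀ hd]
      linarith
    obtain ⟨z, hz, rfl⟩ := happ.surjOn_closedBall_of_nonlinearRightInverse g
      (by positivity) (hball.trans hUs) (a := y) (by
        have : (g.nnnorm : ℝ)⁻¹ - κ = (1 - δ) * ‖f'‖ := by
          simp [g, hκ]; ring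
        rw [this, mul_div_cancel₀ _ hd.ne']
        exact Metric.mem_closedBall.2 le_rfl)
    exact ⟨z, hball hz, rfl⟩
  · rintro _ ⟨z, hz, rfl⟩
    have hzc := hUc hz
    rw [mem_ball_iff_norm] at hzc ⊢
    have h := happ z (hUs hz) c (hUs (hcU (Metric.mem_ball_self hr)))
    have h' : ‖f z - f c - (z - c) * f'‖ ≤ δ * ‖f'‖ * ‖z - c‖ := by
      simpa [hκ] using h
    calc ‖f z - f c‖ = ‖(f z - f c - (z - c) * f') + (z - c) * f'‖ := by ring_nf
      _ ≤ δ * ‖f'‖ * ‖z - c‖ + ‖z - c‖ * ‖f'‖ := (norm_add_le _ _).trans (by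
          rw [norm_mul]; gcongr)
      _ = (1 + δ) * ‖f'‖ * ‖z - c‖ := by ring
      _ < (1 + δ) * ‖f'‖ * (M * r) := by gcongr
      _ = M * (1 + ε) * ((1 - δ) * ‖f'‖ * r) := by rw [hδ']; ring

/-- An analytic function which is injective near a point has nonzero derivative there. -/
theorem AnalyticAt.deriv_ne_zero_of_injOn {f : ℂ → ℂ} {x : ℂ} {W : Set ℂ}
    (hf : AnalyticAt ℂ f x) (hW : W ∈ 𝓝 x) (hinj : InjOn f W) : deriv f x ≠ 0 := by
  intro h0
  have hfx : AnalyticAt ℂ (fun z => f z - f x) x := hf.sub analyticAt_const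
  have htop : analyticOrderAt (fun z => f z - f x) x ≠ ⊤ := by
    rw [Ne, analyticOrderAt_eq_top]
    intro h
    have h' : ∀ᶠ z in 𝓝[≠] x, False := by
      filter_upwards [nhdsWithin_le_nhds h, nhdsWithin_le_nhds hW, self_mem_nhdsWithin]
        with z hz hzW hzx
      exact hzx (hinj hzW (mem_of_mem_nhds hW) (sub_eq_zero.1 hz))
    exact h'.exists.elim fun _ => id
  obtain ⟨n, hn⟩ := ENat.ne_top_iff_exists.1 htop
  obtain ⟨g, hg, hgx, hfg⟩ := (hfx.analyticOrderAt_eq_natCast).1 hn.symm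
  have hn0 : n ≠ 0 := by
    rintro rfl
    exact hgx (by simpa using hfg.self_of_nhds.symm)
  have hn1 : n ≠ 1 := by
    rintro rfl
    have h1 : HasDerivAt (fun z => (z - x) * g z + f x) (g x) x := by
      simpa using! (((hasDerivAt_id x).sub_const x).mul hg.differentiableAt.hasDerivAt).add_const
        (f x)
    refine hgx (h1.deriv.symm.trans (Eq.trans (EventuallyEq.deriv_eq ?_) h0))
    filter_upwards [hfg] with z hz
    simp only [pow_one, smul_eq_mul] at hz
    rw [← hz, sub_add_cancel]
  set u : ℂ → ℂ := fun z => (g z / g x) ^ ((n : ℂ)⁻¹) with hu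
  have hux : u x = 1 := by simp [hu, hgx]
  have hua : AnalyticAt ℂ u x :=
    (hg.div analyticAt_const hgx).cpow analyticAt_const (by simp [hgx])
  set h : ℂ → ℂ := fun z => (z - x) * u z with hh
  have hha : AnalyticAt ℂ h x := (analyticAt_id.sub analyticAt_const).mul hua
  have hh' : HasDerivAt h 1 x := by
    simpa [hux] using! ((hasDerivAt_id x).sub_const x).mul hua.differentiableAt.hasDerivAt
  have hmap : map h (𝓝 x) = 𝓝 0 := by
    have := hha.hasStrictDerivAt.map_nhds_eq (by simp [hh'.deriv])
    simpa [hh] using this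
  have hpow : ∀ᶠ z in 𝓝 x, z ∈ W ∧ f z = h z ^ n * g x + f x := by
    filter_upwards [hfg, hW] with z hz hzW
    refine ⟨hzW, ?_⟩
    simp only [smul_eq_mul] at hz
    rw [hh, mul_pow, hu, Complex.cpow_nat_inv_pow _ hn0, ← sub_eq_iff_eq_add, hz]
    field_simp
  have hS : h '' {z | z ∈ W ∧ f z = h z ^ n * g x + f x} ∈ 𝓝 (0 : ℂ) :=
    hmap ▸ image_mem_map hpow
  have hζ := Complex.isPrimitiveRoot_exp n hn0
  set ζ := Complex.exp (2 * Real.pi * I / n)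
  have hS' : ∀ᶠ w in 𝓝 (0 : ℂ), ζ * w ∈ h '' {z | z ∈ W ∧ f z = h z ^ n * g x + f x} := by
    have : Tendsto (fun w => ζ * w) (𝓝 0) (𝓝 0) := by
      simpa using! (continuous_const_mul ζ).tendsto 0
    exact this hS
  obtain ⟨w, ⟨⟨z₁, ⟨hz₁W, hz₁⟩, rfl⟩, ⟨z₂, ⟨hz₂W, hz₂⟩, hz₂'⟩⟩, hw0⟩ :=
    (((eventually_mem_set.2 hS).and hS').filter_mono nhdsWithin_le_nhds |>.and
      (self_mem_nhdsWithin (s := {0}ᶜ))).exists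
  have heq : z₂ = z₁ := hinj hz₂W hz₁W (by
    rw [hz₁, hz₂, hz₂', mul_pow, hζ.pow_eq_one, one_mul])
  rw [heq] at hz₂'
  have hζ1 : ζ = 1 := by
    have : (ζ - 1) * h z₁ = 0 := by linear_combination -hz₂'
    exact sub_eq_zero.1 ((mul_eq_zero.1 this).resolve_right hw0)
  exact hζ.ne_one (by omega) hζ1

/-- If `f` is an injective holomorphic map near `x` and `Aₙ ∋ x` are open sets with diameters
tending to zero, then `E(f(Aₙ)) = (1 + o(1)) E(Aₙ)`, i.e. `E(f(Aₙ))/E(Aₙ) → 1`. -/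
theorem ecc_image_asymp_of_conformal
    (x : ℂ) (W : Set ℂ) (hW : IsOpen W) (hxW : x ∈ W)
    (f : ℂ → ℂ) (hf : DifferentiableOn ℂ f W) (hinj : InjOn f W)
    (A : ℕ → Set ℂ) (hA : ∀ n, A n ⊆ W) (hopen : ∀ n, IsOpen (A n)) (hx : ∀ n, x ∈ A n)
    (hdiam : Tendsto (fun n => EMetric.diam (A n)) atTop (nhds 0)) :
    Tendsto (fun n => ecc (f '' A n) / ecc (A n)) atTop (nhds 1) := by
  have hWx : W ∈ 𝓝 x := hW.mem_nhds hxW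
  have han : AnalyticAt ℂ f x := hf.analyticAt hWx
  have hne := han.deriv_ne_zero_of_injOn hWx hinj
  have hsd := han.hasStrictDerivAt
  have hsmall : Tendsto A atTop (𝓝 x).smallSets := by
    rw [tendsto_smallSets_iff]
    intro t ht
    obtain ⟨ε, hε, hεt⟩ := EMetric.mem_nhds_iff.1 ht
    filter_upwards [hdiam.eventually (gt_mem_nhds hε)] with n hn y hy
    exact hεt ((Metric.edist_le_ediam_of_mem hy (hx n)).trans_lt hn)
  have hsmall' : Tendsto (fun n => f '' A n) atTop (𝓝 (f x)).smallSets := by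
    rw [tendsto_smallSets_iff] at hsmall ⊢
    intro t ht
    filter_upwards [hsmall _ (han.continuousAt.preimage_mem_nhds ht)] with n hn
    exact image_subset_iff.2 hn
  have hint : ∀ n, (interior (A n)).Nonempty := fun n =>
    ⟨x, (hopen n).interior_eq.symm ▸ hx n⟩
  have hint' : ∀ n, (interior (f '' A n)).Nonempty := fun n =>
    ⟨f x, mem_interior_iff_mem_nhds.2
      (hsd.map_nhds_eq hne ▸ image_mem_map ((hopen n).mem_nhds (hx n)))⟩
  have hone : ∀ᶠ n in atTop, 1 ≤ ecc (A n) := by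
    filter_upwards [hsmall.eventually (eventually_smallSets_subset.2
      (Metric.ball_mem_nhds x one_pos))] with n hn
    exact one_le_ecc (hint n) (Metric.isBounded_ball.subset hn)
  have hinv : ∀ᶠ n in atTop, hsd.localInverse f _ x hne '' (f '' A n) = A n := by
    filter_upwards [hsmall.eventually (eventually_smallSets_subset.2
      (hsd.eventually_left_inverse hne))] with n hn
    rw [image_image]
    exact (image_congr fun z hz => hn hz).trans (image_id' _)
  have hinv_ne : (deriv f x)⁻¹ ≠ 0 := inv_ne_zero hne
  have hupper : ∀ ε > 0, ∀ᶠ n in atTop, ecc (f '' A n) / ecc (A n) ≤ 1 + ε := by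
    intro ε hε
    filter_upwards [hone, hsmall.eventually (hsd.eventually_ecc_image_le hne hε)] with n h1 h
    exact (div_le_iff₀ (by linarith)).2 (h (hint n))
  have hlower : ∀ ε > 0, ∀ᶠ n in atTop, (1 + ε)⁻¹ ≤ ecc (f '' A n) / ecc (A n) := by
    intro ε hε
    filter_upwards [hone, hinv, hsmall'.eventually
      ((hsd.to_localInverse hne).eventually_ecc_image_le hinv_ne hε)] with n h1 hi h
    have h2 := h (hint' n)
    rw [hi] at h2
    rw [le_div_iff₀ (by linarith), inv_mul_le_iff₀ (by linarith)]
    exact h2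
  refine tendsto_order.2 ⟨fun a ha => ?_, fun a ha => ?_⟩
  · have hcont : Tendsto (fun ε : ℝ => (1 + ε)⁻¹) (𝓝[>] 0) (𝓝 1) := by
      have : ContinuousAt (fun ε : ℝ => (1 + ε)⁻¹) 0 := by fun_prop (disch := norm_num)
      simpa using this.tendsto.mono_left nhdsWithin_le_nhds
    obtain ⟨ε, hεa, hε⟩ := ((hcont.eventually (lt_mem_nhds ha)).and self_mem_nhdsWithin).exists
    exact (hlower ε hε).mono fun n hn => hεa.trans_le hn
  · filter_upwards [hupper ((a - 1) / 2) (by linarith)] with n hn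
    linarith

end
end
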